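/- Let T and T' be finite trees, each having at least one vertex of degree at least 3. If their bivariate subtree polynomials are equal, i.e. S_T(q,r) = S_{T'}(q,r), then the multiset of lengths (numbers of edges) of the twigs of T equals the multiset of lengths of the twigs of T'. -/

import Mathlib

open scoped Classical

noncomputable section

variable {V : Type*}

/-- A coloring `κ : V → ℕ` is proper if adjacent vertices get distinct colors. -/
def Proper (G : SimpleGraph V) (κ : V → ℕ) : Prop :=
  ∀ ⦃u v : V⦄, G.Adj u v → κ u ≠ κ v

/-- The chromatic symmetric function of `G`, as a formal power series in the
variables `x_0, x_1, x_2, …`: the coefficient of the monomial `∏ i, x_i ^ m i`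
is the number of proper colorings `κ : V → ℕ` using color `i` exactly `m i` times. -/
def csf [Fintype V] (G : SimpleGraph V) : MvPowerSeries ℕ ℤ :=
  fun m => (Nat.card {κ : V → ℕ // Proper G κ ∧ ∀ i : ℕ, Nat.card {v : V // κ v = i} = m i} : ℤ)

/-- `A` is (the vertex set of) a subtree of `T`: the induced subgraph on `A` is
connected and has at least one edge. -/
def IsSubtree [Fintype V] (T : SimpleGraph V) (A : Finset V) : Prop :=
  (T.induce (A : Set V)).Connected ∧ ∃ u ∈ A, ∃ v ∈ A, T.Adj u v

/-- The number of edges of the subgraph of `T` induced on `A`. -/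
def edgeCount [Fintype V] (T : SimpleGraph V) (A : Finset V) : ℕ :=
  Nat.card (T.induce (A : Set V)).edgeSet

/-- The number of leaves (vertices of degree 1) of the subgraph of `T` induced on `A`. -/
def leafCount [Fintype V] (T : SimpleGraph V) (A : Finset V) : ℕ :=
  Nat.card {v : (A : Set V) // Nat.card ((T.induce (A : Set V)).neighborSet v) = 1}

/-- The bivariate subtree polynomial `S_T(q, r) = ∑_{subtrees S of T} q^{|E(S)|} r^{|L(S)|}`,
with `q = X 0` and `r = X 1`. -/
def subtreePoly [Fintype V] (T : SimpleGraph V) : MvPolynomial (Fin 2) ℤ :=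
  ∑ A ∈ Finset.univ.powerset.filter (fun A => IsSubtree T A),
    MvPolynomial.X 0 ^ edgeCount T A * MvPolynomial.X 1 ^ leafCount T A

/-- The degree sequence of `T`, as a multiset. -/
def degreeSequence [Fintype V] (T : SimpleGraph V) : Multiset ℕ :=
  Finset.univ.val.map (fun v => T.degree v)

/-- The set of leaves (vertices of degree 1) of `T`. -/
def leaves [Fintype V] (T : SimpleGraph V) : Finset V :=
  Finset.univ.filter (fun v => T.degree v = 1)

/-- `A` is (the vertex set of) the trunk of `T`: the smallest connected induced
subgraph of `T` containing every vertex of degree at least 3. -/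
def IsTrunk [Fintype V] (T : SimpleGraph V) (A : Finset V) : Prop :=
  (T.induce (A : Set V)).Connected ∧ (∀ v : V, 3 ≤ T.degree v → v ∈ A) ∧
    ∀ B : Finset V, (T.induce (B : Set V)).Connected → (∀ v : V, 3 ≤ T.degree v → v ∈ B) →
      A ⊆ B

/-- Every interior (non-endpoint) vertex of the walk `P` has degree 2 in `T`. -/
def InteriorDeg2 [Fintype V] (T : SimpleGraph V) {a b : V} (P : T.Walk a b) : Prop :=
  ∀ v ∈ P.support, v ≠ a → v ≠ b → T.degree v = 2

/-- `P` is the twig of `l`: the longest path in `T` containing `l` all of whose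
interior vertices have degree 2 in `T`. -/
def IsTwig [Fintype V] (T : SimpleGraph V) (l : V) {a b : V} (P : T.Walk a b) : Prop :=
  P.IsPath ∧ l ∈ P.support ∧ InteriorDeg2 T P ∧
    ∀ ⦃a' b' : V⦄ (Q : T.Walk a' b'), Q.IsPath → l ∈ Q.support → InteriorDeg2 T Q →
      Q.length ≤ P.length

/-- The length (number of edges) of the twig of `l`: the maximal length of a path
in `T` containing `l` all of whose interior vertices have degree 2 in `T`. -/
def twigLen [Fintype V] (T : SimpleGraph V) (l : V) : ℕ :=
  sSup {n : ℕ | ∃ (a b : V) (P : T.Walk a b),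
    P.IsPath ∧ l ∈ P.support ∧ InteriorDeg2 T P ∧ P.length = n}

/-- The multiset of lengths of the twigs of `T` (one twig for each leaf). -/
def twigLengths [Fintype V] (T : SimpleGraph V) : Multiset ℕ :=
  (leaves T).val.map (twigLen T)

end

open Polynomial in
theorem Multiset.eq_of_prod_X_pow_sub_one_eq (s s' : Multiset ℕ) (hs : ∀ t ∈ s, 0 < t)
    (hs' : ∀ t ∈ s', 0 < t)
    (h : (s.map fun t => (X : ℂ[X]) ^ t - 1).prod = (s'.map fun t => (X : ℂ[X]) ^ t - 1).prod) :
    s = s' := by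
  have key : ∀ s s' : Multiset ℕ, (∀ t ∈ s, 0 < t) →
      (s.map fun t => (X : ℂ[X]) ^ t - 1).prod = (s'.map fun t => (X : ℂ[X]) ^ t - 1).prod →
      ∀ m ∈ s, ∃ t ∈ s', m ∣ t := by
    intro s s' hs h m hm
    have hz := Complex.isPrimitiveRoot_exp m (hs m hm).ne'
    set z := Complex.exp (2 * Real.pi * Complex.I / m)
    have h0 : ((s.map fun t => (X : ℂ[X]) ^ t - 1).prod).eval z = 0 := by
      rw [Polynomial.eval_multiset_prod, Multiset.map_map, Multiset.prod_eq_zero_iff,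
        Multiset.mem_map]
      exact ⟨m, hm, by simp [hz.pow_eq_one]⟩
    rw [h, Polynomial.eval_multiset_prod, Multiset.map_map, Multiset.prod_eq_zero_iff,
      Multiset.mem_map] at h0
    obtain ⟨t, ht, h1⟩ := h0
    refine ⟨t, ht, hz.dvd_of_pow_eq_one t ?_⟩
    simpa [sub_eq_zero] using h1
  induction hn : s.card generalizing s s' with
  | zero =>
    rw [Multiset.card_eq_zero] at hn
    subst hn
    by_contra hne
    obtain ⟨t, ht⟩ := Multiset.exists_mem_of_ne_zero (Ne.symm hne)
    obtain ⟨u, hu, -⟩ := key s' 0 hs' h.symm t ht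
    simp at hu
  | succ n ih =>
    have hne : s.toFinset.Nonempty := by
      obtain ⟨a, ha⟩ := Multiset.card_pos_iff_exists_mem.mp (by omega : 0 < s.card)
      exact ⟨a, by simpa using ha⟩
    obtain ⟨m, hm, hmax⟩ := s.toFinset.exists_max_image id hne
    simp only [Multiset.mem_toFinset, id] at hm hmax
    obtain ⟨t, ht, hmt⟩ := key s s' hs h m hm
    obtain ⟨u, hu, htu⟩ := key s' s hs' h.symm t ht
    have h1 := Nat.le_of_dvd (hs' t ht) hmt
    have h2 := Nat.le_of_dvd (hs u hu) htu
    have h3 := hmax u hu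
    obtain rfl : t = m := by omega
    obtain ⟨r, rfl⟩ := Multiset.exists_cons_of_mem hm
    obtain ⟨r', rfl⟩ := Multiset.exists_cons_of_mem ht
    rw [Multiset.card_cons] at hn
    simp only [Multiset.map_cons, Multiset.prod_cons] at h
    have hX : (X : ℂ[X]) ^ t - 1 ≠ 0 := X_pow_sub_C_ne_zero (hs t hm) 1
    rw [ih r r' (fun x hx => hs x (Multiset.mem_cons_of_mem hx))
      (fun x hx => hs' x (Multiset.mem_cons_of_mem hx)) (mul_left_cancel₀ hX h) (by omega)]

/-- `p` sends each vertex of the tree `T` rooted at `b` to its neighbour towards `b`, and `d` is a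
depth function decreasing along `p`. -/
structure IsParentMap {V : Type*} (T : SimpleGraph V) (b : V) (p : V → V) (d : V → ℕ) : Prop where
  root : p b = b
  adj : ∀ v, v ≠ b → T.Adj v (p v)
  eq_or_eq : ∀ u v, T.Adj u v → (u ≠ b ∧ p u = v) ∨ (v ≠ b ∧ p v = u)
  depth_lt : ∀ v, v ≠ b → d (p v) < d v
  connected_iff : ∀ A : Set V, b ∈ A → ((T.induce A).Connected ↔ ∀ v ∈ A, p v ∈ A)

theorem SimpleGraph.IsTree.exists_isParentMap {V : Type*} {T : SimpleGraph V} (hT : T.IsTree)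
    (b : V) : ∃ p d, IsParentMap T b p d := by
  choose P hP hPu using fun v => hT.existsUnique_path v b
  have hnil : ∀ v, v ≠ b → ¬ (P v).Nil := fun v hv h => hv h.eq
  have hadj : ∀ v, v ≠ b → T.Adj v (P v).snd := fun v hv => (P v).adj_snd (hnil v hv)
  have hdepth : ∀ v, v ≠ b → (P (P v).snd).length < (P v).length := by
    intro v hv
    have h1 := (P v).length_tail_add_one (hnil v hv)
    have h2 : (P v).tail = P (P v).snd := hPu _ _ (hP v).tail
    rw [← h2]; omega
  have hroot : (P b).snd = b := by
    have : (SimpleGraph.Walk.nil : T.Walk b b) = P b := hPu b _ SimpleGraph.Walk.IsPath.nil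
    rw [← this]; rfl
  refine ⟨fun v => (P v).snd, fun v => (P v).length, hroot, hadj, ?_, hdepth, ?_⟩
  · intro u v huv
    by_cases hu : u ∈ (P v).support
    · right
      refine ⟨?_, (hT.isAcyclic.eq_snd_of_adj_start (hP v) huv.symm hu).symm⟩
      rintro rfl
      have : (SimpleGraph.Walk.nil : T.Walk v v) = P v := hPu v _ SimpleGraph.Walk.IsPath.nil
      rw [← this] at hu
      simp at hu
      exact huv.ne hu
    · left
      refine ⟨fun h => hu (h ▸ (P v).end_mem_support), ?_⟩
      have : SimpleGraph.Walk.cons huv (P v) = P u := hPu u _ ((hP v).cons hu)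
      rw [← this]; simp
  · intro A hb
    constructor
    · intro hA v hv
      by_cases hvb : v = b
      · subst hvb; simpa only [hroot] using hv
      obtain ⟨W, hW⟩ := (hA.preconnected ⟨v, hv⟩ ⟨b, hb⟩).exists_isPath
      have hW_mem : ∀ x ∈ (W.map (SimpleGraph.Embedding.induce (G := T) A).toHom).support,
          x ∈ A := by
        intro x hx
        rw [SimpleGraph.Walk.support_map, List.mem_map] at hx
        obtain ⟨y, -, rfl⟩ := hx
        exact y.2
      have h1 : W.map (SimpleGraph.Embedding.induce A).toHom = P v :=
        hPu v _ (hW.map (SimpleGraph.Embedding.induce (G := T) A).injective)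
      have h2 : (P v).snd ∈ (P v).support := (P v).getVert_mem_support 1
      exact hW_mem _ ((congrArg SimpleGraph.Walk.support h1) ▸ h2)
    · intro hA
      have key : ∀ n, ∀ v (hv : v ∈ A), (P v).length = n →
          (T.induce A).Reachable ⟨v, hv⟩ ⟨b, hb⟩ := by
        intro n
        induction n using Nat.strong_induction_on with
        | _ n ih =>
          intro v hv hn
          by_cases hvb : v = b
          · subst hvb; rfl
          have h1 := ih _ (hn ▸ hdepth v hvb) _ (hA v hv) rfl
          refine SimpleGraph.Reachable.trans (SimpleGraph.Adj.reachable ?_) h1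
          exact hadj v hvb
      have : Nonempty A := ⟨⟨b, hb⟩⟩
      exact ⟨fun u v => (key _ u.1 u.2 rfl).trans (key _ v.1 v.2 rfl).symm⟩

open Finset in
theorem Finset.natCard_subtype_coe {V : Type*} (A : Finset V) (Q : V → Prop) [DecidablePred Q] :
    Nat.card {v : (A : Set V) // Q v} = #{v ∈ A | Q v} := by
  let e : {v : (A : Set V) // Q v} ≃ ({v ∈ A | Q v} : Finset V) :=
    { toFun := fun x => ⟨x.1.1, Finset.mem_filter.mpr ⟨x.1.2, x.2⟩⟩
      invFun := fun x => ⟨⟨x.1, (Finset.mem_filter.mp x.2).1⟩, (Finset.mem_filter.mp x.2).2⟩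
      left_inv := fun _ => rfl
      right_inv := fun _ => rfl }
  rw [Nat.card_congr e, Nat.card_eq_fintype_card, Fintype.card_coe]

open Finset in
theorem card_neighborSet_induce {V : Type*} [Fintype V] (T : SimpleGraph V) (A : Finset V)
    (v : (A : Set V)) :
    Nat.card ((T.induce (A : Set V)).neighborSet v) = #{u ∈ A | T.Adj v u} :=
  Finset.natCard_subtype_coe A fun u => T.Adj v u

open Finset in
theorem leafCount_eq_card_filter {V : Type*} [Fintype V] (T : SimpleGraph V) (A : Finset V) :
    leafCount T A = #{v ∈ A | #{u ∈ A | T.Adj v u} = 1} := by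
  unfold leafCount
  simp only [card_neighborSet_induce]
  exact Finset.natCard_subtype_coe A fun v => #{u ∈ A | T.Adj v u} = 1

open Finset in
theorem IsSubtree.edgeCount_add_one {V : Type*} [Fintype V] {T : SimpleGraph V} (hT : T.IsTree)
    {A : Finset V} (hA : IsSubtree T A) : edgeCount T A + 1 = #A := by
  have h : (T.induce (A : Set V)).IsTree := ⟨hA.1, hT.isAcyclic.induce _⟩
  have := h.card_edgeFinset
  rw [edgeCount, Nat.card_eq_fintype_card, ← SimpleGraph.edgeFinset_card, this]
  simp

open Finset in
theorem sum_card_adj_eq_two_mul_edgeCount {V : Type*} [Fintype V] (T : SimpleGraph V)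
    (A : Finset V) : ∑ v ∈ A, #{u ∈ A | T.Adj v u} = 2 * edgeCount T A := by
  have h := (T.induce (A : Set V)).sum_degrees_eq_twice_card_edges
  rw [edgeCount, Nat.card_eq_fintype_card, ← SimpleGraph.edgeFinset_card, ← h,
    ← Finset.sum_coe_sort A]
  refine Finset.sum_congr rfl fun v _ => ?_
  rw [← card_neighborSet_induce T A v, Nat.card_eq_fintype_card, SimpleGraph.card_neighborSet_eq_degree]

open Finset in
theorem IsSubtree.one_le_card_adj {V : Type*} [Fintype V] {T : SimpleGraph V}
    {A : Finset V} (hA : IsSubtree T A) {v : V} (hv : v ∈ A) : 1 ≤ #{u ∈ A | T.Adj v u} := by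
  obtain ⟨hc, x, hx, y, hy, hxy⟩ := hA
  have : Nontrivial (A : Set V) := ⟨⟨x, hx⟩, ⟨y, hy⟩, fun h => hxy.ne (congrArg Subtype.val h)⟩
  have h := hc.preconnected.degree_pos_of_nontrivial ⟨v, hv⟩
  rwa [← SimpleGraph.card_neighborSet_eq_degree, ← Nat.card_eq_fintype_card,
    card_neighborSet_induce] at h

open Finset in
theorem IsSubtree.leafCount_eq {V : Type*} [Fintype V] {T : SimpleGraph V} (hT : T.IsTree)
    {A : Finset V} (hA : IsSubtree T A) :
    leafCount T A = 2 + ∑ v ∈ A, (#{u ∈ A | T.Adj v u} - 2) := by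
  have h1 := hA.edgeCount_add_one hT
  have h2 := sum_card_adj_eq_two_mul_edgeCount T A
  have h3 : ∑ v ∈ A, (#{u ∈ A | T.Adj v u} + if #{u ∈ A | T.Adj v u} = 1 then 1 else 0) =
      ∑ v ∈ A, ((#{u ∈ A | T.Adj v u} - 2) + 2) := by
    refine Finset.sum_congr rfl fun v hv => ?_
    have := hA.one_le_card_adj hv
    split_ifs <;> omega
  rw [Finset.sum_add_distrib, Finset.sum_add_distrib, ← Finset.card_filter,
    ← leafCount_eq_card_filter, h2, Finset.sum_const, smul_eq_mul] at h3
  omega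

theorem SimpleGraph.IsTree.isSubtree_univ {V : Type*} [Fintype V] {T : SimpleGraph V}
    (hT : T.IsTree) (hdeg : ∃ v : V, 3 ≤ T.degree v) : IsSubtree T Finset.univ := by
  obtain ⟨v, hv⟩ := hdeg
  constructor
  · rw [Finset.coe_univ]
    exact (SimpleGraph.induceUnivIso T).connected_iff.mpr hT.connected
  · obtain ⟨u, hu⟩ := Finset.card_pos.mp
      (by rw [SimpleGraph.card_neighborFinset_eq_degree]; omega : 0 < (T.neighborFinset v).card)
    exact ⟨v, Finset.mem_univ _, u, Finset.mem_univ _, by simpa using hu⟩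

open Finset in
theorem card_filter_adj_eq_degree {V : Type*} [Fintype V] (T : SimpleGraph V) (v : V) :
    #{u | T.Adj v u} = T.degree v := by
  rw [← SimpleGraph.card_neighborFinset_eq_degree, SimpleGraph.neighborFinset_eq_filter]

open Finset in
theorem leafCount_univ {V : Type*} [Fintype V] (T : SimpleGraph V) :
    leafCount T univ = #(leaves T) := by
  rw [leafCount_eq_card_filter, leaves]
  simp only [card_filter_adj_eq_degree]

open Finset in
theorem sum_sub_two_eq_sum_ite {V : Type*} [Fintype V] {T : SimpleGraph V}
    (A : Finset V) : ∑ v ∈ A, (#{u ∈ A | T.Adj v u} - 2) =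
      ∑ v, if v ∈ A then #{u ∈ A | T.Adj v u} - 2 else 0 := by
  simp

open Finset in
theorem ite_card_adj_sub_two_le {V : Type*} [Fintype V] (T : SimpleGraph V)
    (A : Finset V) (v : V) :
    (if v ∈ A then #{u ∈ A | T.Adj v u} - 2 else 0) ≤ T.degree v - 2 := by
  split_ifs
  · rw [← card_filter_adj_eq_degree]
    exact Nat.sub_le_sub_right
      (Finset.card_le_card (Finset.filter_subset_filter _ (Finset.subset_univ A))) 2
  · exact Nat.zero_le _

open Finset in
theorem card_leaves_eq {V : Type*} [Fintype V] {T : SimpleGraph V} (hT : T.IsTree)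
    (hdeg : ∃ v : V, 3 ≤ T.degree v) : #(leaves T) = 2 + ∑ v, (T.degree v - 2) := by
  rw [← leafCount_univ, (hT.isSubtree_univ hdeg).leafCount_eq hT]
  simp only [card_filter_adj_eq_degree]

open Finset in
theorem IsSubtree.leafCount_le {V : Type*} [Fintype V] {T : SimpleGraph V} (hT : T.IsTree)
    (hdeg : ∃ v : V, 3 ≤ T.degree v) {A : Finset V} (hA : IsSubtree T A) :
    leafCount T A ≤ #(leaves T) := by
  rw [card_leaves_eq hT hdeg, hA.leafCount_eq hT, sum_sub_two_eq_sum_ite]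
  exact Nat.add_le_add_left (Finset.sum_le_sum fun v _ => ite_card_adj_sub_two_le T A v) 2

open Finset in
theorem IsSubtree.leafCount_eq_card_leaves_iff {V : Type*} [Fintype V] {T : SimpleGraph V}
    (hT : T.IsTree) (hdeg : ∃ v : V, 3 ≤ T.degree v) {A : Finset V} (hA : IsSubtree T A) :
    leafCount T A = #(leaves T) ↔ ∀ v, 3 ≤ T.degree v → v ∈ A ∧ ∀ u, T.Adj v u → u ∈ A := by
  rw [card_leaves_eq hT hdeg, hA.leafCount_eq hT, sum_sub_two_eq_sum_ite, Nat.add_left_cancel_iff,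
    Finset.sum_eq_sum_iff_of_le fun v _ => ite_card_adj_sub_two_le T A v]
  refine forall_congr' fun v => ?_
  simp only [Finset.mem_univ, true_implies]
  constructor
  · intro h hv
    split_ifs at h with hvA
    · refine ⟨hvA, fun u hu => ?_⟩
      have h1 : #{u ∈ A | T.Adj v u} = #{u | T.Adj v u} := by
        rw [card_filter_adj_eq_degree]; omega
      have h2 := Finset.eq_of_subset_of_card_le
        (Finset.filter_subset_filter (T.Adj v) (Finset.subset_univ A)) h1.ge
      have h3 : u ∈ ({u | T.Adj v u} : Finset V) := by simpa using hu
      rw [← h2] at h3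
      exact (Finset.mem_filter.mp h3).1
    · omega
  · intro h
    by_cases hv : 3 ≤ T.degree v
    · obtain ⟨hvA, hu⟩ := h hv
      rw [if_pos hvA, ← card_filter_adj_eq_degree]
      congr 2
      ext u
      simpa using hu u
    · have := ite_card_adj_sub_two_le T A v
      omega

/-- The number of steps along `p` needed to get from `v` to a vertex of degree at least `3`. -/
noncomputable def branchDist {V : Type*} [Fintype V] (T : SimpleGraph V) (p : V → V) (v : V) : ℕ :=
  sInf {i | 3 ≤ T.degree (p^[i] v)}

theorem degree_iterate_lt_three {V : Type*} [Fintype V] {T : SimpleGraph V} {p : V → V} {v : V}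
    {i : ℕ} (hi : i < branchDist T p v) : T.degree (p^[i] v) < 3 :=
  not_le.mp (Nat.notMem_of_lt_sInf (s := {i | 3 ≤ T.degree (p^[i] v)}) hi)

namespace IsParentMap

variable {V : Type*} [Fintype V] {T : SimpleGraph V} {b : V} {p : V → V} {d : V → ℕ}

omit [Fintype V] in
theorem exists_iterate_eq_root (h : IsParentMap T b p d) (v : V) : ∃ i, p^[i] v = b := by
  induction hn : d v using Nat.strong_induction_on generalizing v with
  | _ n ih =>
    by_cases hv : v = b
    · exact ⟨0, hv⟩
    · obtain ⟨i, hi⟩ := ih _ (hn ▸ h.depth_lt v hv) (p v) rfl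
      exact ⟨i + 1, hi⟩

theorem three_le_degree_of_parent_eq (h : IsParentMap T b p d) (hb : 3 ≤ T.degree b) {u v : V}
    (hu : u ≠ b) (hv : v ≠ b) (huv : u ≠ v) (hp : p u = p v) : 3 ≤ T.degree (p u) := by
  by_cases hpb : p u = b
  · rwa [hpb]
  have h1 := h.depth_lt u hu
  have h2 := h.depth_lt v hv
  have h3 := h.depth_lt _ hpb
  have hsub : ({u, v, p (p u)} : Finset V) ⊆ T.neighborFinset (p u) := by
    intro x hx
    simp only [Finset.mem_insert, Finset.mem_singleton] at hx
    rw [SimpleGraph.mem_neighborFinset]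
    rcases hx with rfl | rfl | rfl
    · exact (h.adj _ hu).symm
    · exact hp ▸ (h.adj _ hv).symm
    · exact h.adj _ hpb
  have hcard : ({u, v, p (p u)} : Finset V).card = 3 := by
    refine Finset.card_eq_three.mpr ⟨u, v, p (p u), huv, ?_, ?_, rfl⟩
    · intro he; rw [← he] at h3; omega
    · intro he; rw [← he, hp] at h3; omega
  rw [← SimpleGraph.card_neighborFinset_eq_degree, ← hcard]
  exact Finset.card_le_card hsub

theorem two_le_degree_parent (h : IsParentMap T b p d) (hb : 3 ≤ T.degree b) {v : V}
    (hv : v ≠ b) : 2 ≤ T.degree (p v) := by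
  by_cases hpb : p v = b
  · rw [hpb]; omega
  have h1 := h.depth_lt v hv
  have h3 := h.depth_lt _ hpb
  have hsub : ({v, p (p v)} : Finset V) ⊆ T.neighborFinset (p v) := by
    intro x hx
    simp only [Finset.mem_insert, Finset.mem_singleton] at hx
    rw [SimpleGraph.mem_neighborFinset]
    rcases hx with rfl | rfl
    · exact (h.adj _ hv).symm
    · exact h.adj _ hpb
  rw [← SimpleGraph.card_neighborFinset_eq_degree, ← Finset.card_pair (a := v) (b := p (p v))]
  · exact Finset.card_le_card hsub
  · intro he; rw [← he] at h3; omega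

theorem degree_pos (h : IsParentMap T b p d) {v : V} (hv : v ≠ b) : 0 < T.degree v :=
  (T.degree_pos_iff_exists_adj v).mpr ⟨p v, h.adj v hv⟩

theorem exists_child (h : IsParentMap T b p d) {v : V} (hdeg : 2 ≤ T.degree v) :
    ∃ w, w ≠ b ∧ p w = v := by
  rw [← SimpleGraph.card_neighborFinset_eq_degree] at hdeg
  obtain ⟨w, hw, hne⟩ := Finset.exists_mem_ne hdeg (p v)
  rw [SimpleGraph.mem_neighborFinset] at hw
  rcases h.eq_or_eq v w hw with ⟨-, h1⟩ | h1
  · exact absurd h1.symm hne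
  · exact ⟨w, h1⟩

theorem three_le_degree_branch (h : IsParentMap T b p d) (hb : 3 ≤ T.degree b) (v : V) :
    3 ≤ T.degree (p^[branchDist T p v] v) := by
  obtain ⟨i, hi⟩ := h.exists_iterate_eq_root v
  exact Nat.sInf_mem (s := {i | 3 ≤ T.degree (p^[i] v)}) 
    ⟨i, by rwa [Set.mem_ofPred_eq, hi]⟩

theorem branchDist_pos (h : IsParentMap T b p d) (hb : 3 ≤ T.degree b) {v : V}
    (hv : T.degree v = 1) : 0 < branchDist T p v := by
  by_contra h0
  have := h.three_le_degree_branch hb v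
  rw [Nat.eq_zero_of_not_pos h0, Function.iterate_zero, id, hv] at this
  omega

theorem iterate_ne_root (hb : 3 ≤ T.degree b) {v : V} {i : ℕ} (hi : i < branchDist T p v) :
    p^[i] v ≠ b := by
  intro he
  have := degree_iterate_lt_three hi
  rw [he] at this
  omega

theorem iterate_inj (h : IsParentMap T b p d) (hb : 3 ≤ T.degree b) {l l' : V}
    (hl : T.degree l = 1) (hl' : T.degree l' = 1) {i j : ℕ} (hi : i < branchDist T p l)
    (hj : j < branchDist T p l') (he : p^[i] l = p^[j] l') : l = l' ∧ i = j := by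
  induction i generalizing j with
  | zero =>
    cases j with
    | zero => exact ⟨he, rfl⟩
    | succ j =>
      have := h.two_le_degree_parent hb (iterate_ne_root hb (Nat.lt_of_succ_lt hj))
      rw [← Function.iterate_succ_apply' p, ← he, Function.iterate_zero, id, hl] at this
      omega
  | succ i ih =>
    cases j with
    | zero =>
      have := h.two_le_degree_parent hb (iterate_ne_root hb (Nat.lt_of_succ_lt hi))
      rw [← Function.iterate_succ_apply' p, he, Function.iterate_zero, id, hl'] at this
      omega
    | succ j =>
      have hi' := Nat.lt_of_succ_lt hi
      have hj' := Nat.lt_of_succ_lt hj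
      have hlt := degree_iterate_lt_three hi
      rw [Function.iterate_succ_apply', Function.iterate_succ_apply'] at he
      rw [Function.iterate_succ_apply'] at hlt
      have : p^[i] l = p^[j] l' := by
        by_contra hne
        have := h.three_le_degree_of_parent_eq hb (iterate_ne_root hb hi')
          (iterate_ne_root hb hj') hne he
        omega
      obtain ⟨h1, h2⟩ := ih hi' hj' this
      exact ⟨h1, by omega⟩

omit [Fintype V] in
theorem exists_isPath_iterate (h : IsParentMap T b p d) (n : ℕ) (v : V)
    (hn : ∀ i < n, p^[i] v ≠ b) : ∃ (w : V) (W : T.Walk v w), w = p^[n] v ∧ W.IsPath ∧ W.length = n ∧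
      ∀ x ∈ W.support, d x ≤ d v ∧ ∃ i ≤ n, x = p^[i] v := by
  induction n generalizing v with
  | zero => exact ⟨v, .nil, rfl, .nil, rfl, by simp⟩
  | succ n ih =>
    have hv : v ≠ b := hn 0 (Nat.succ_pos n)
    obtain ⟨w, W, hw, hW, hlen, hsupp⟩ := ih (p v) fun i hi => hn (i + 1) (by omega)
    have hlt := h.depth_lt v hv
    refine ⟨w, .cons (h.adj v hv) W, hw, hW.cons fun hx => ?_, by simp [hlen], ?_⟩
    · have := (hsupp v hx).1
      omega
    · intro x hx
      rw [SimpleGraph.Walk.support_cons, List.mem_cons] at hx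
      rcases hx with rfl | hx
      · exact ⟨le_rfl, 0, by omega, rfl⟩
      · obtain ⟨h1, i, hi, hxi⟩ := hsupp x hx
        exact ⟨by omega, i + 1, by omega, hxi⟩

theorem getVert_eq_iterate (h : IsParentMap T b p d) {l c : V}
    (hl : T.degree l = 1) (hb : 3 ≤ T.degree b) (P : T.Walk l c) (hP : P.IsPath) (i : ℕ)
    (hi : i ≤ P.length) (hit : i ≤ branchDist T p l) : P.getVert i = p^[i] l := by
  induction i using Nat.strong_induction_on with
  | _ i ih_all =>
    obtain _ | i := i
    · simp
    have ih := ih_all i (by omega) (by omega) (by omega)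
    have hadj := P.adj_getVert_succ (i := i) (by omega)
    rw [Function.iterate_succ_apply', ← ih]
    rcases h.eq_or_eq _ _ hadj with ⟨-, h1⟩ | ⟨h1, h2⟩
    · exact h1.symm
    · exfalso
      cases i with
      | zero =>
        have := h.two_le_degree_parent hb h1
        rw [h2, SimpleGraph.Walk.getVert_zero, hl] at this
        omega
      | succ i =>
        have hlt := degree_iterate_lt_three (show i + 1 < branchDist T p l by omega)
        have hne := iterate_ne_root (p := p) hb (show i < branchDist T p l by omega)
        have h3 : P.getVert i = p^[i] l := ih_all i (by omega) (by omega) (by omega)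
        rw [ih, Function.iterate_succ_apply'] at h2
        have heq : P.getVert (i + 1 + 1) = P.getVert i := by
          by_contra hne'
          rw [h3] at hne'
          have := h.three_le_degree_of_parent_eq hb h1 hne hne' h2
          rw [h2, ← Function.iterate_succ_apply' p, Nat.succ_eq_add_one] at this
          omega
        have := hP.getVert_injOn (by simp; omega) (by simp; omega) heq
        omega

theorem twigLen_eq (h : IsParentMap T b p d) (hb : 3 ≤ T.degree b) {l : V}
    (hl : T.degree l = 1) : twigLen T l = branchDist T p l := by
  have hupper : ∀ {c : V} (P : T.Walk l c), P.IsPath → InteriorDeg2 T P →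
      P.length ≤ branchDist T p l := by
    intro c P hP hint
    by_contra hlt
    rw [not_le] at hlt
    have h1 := h.getVert_eq_iterate hl hb P hP _ hlt.le le_rfl
    have h2 := h.three_le_degree_branch hb l
    rw [← h1] at h2
    have h3 := hint _ (P.getVert_mem_support (branchDist T p l))
      (fun he => by rw [he] at h2; omega)
      (fun he => by
        have := (hP.getVert_eq_end_iff hlt.le).mp he
        omega)
    omega
  refine IsGreatest.csSup_eq ⟨?_, ?_⟩
  · obtain ⟨c, W, hc, hW, hlen, hsupp⟩ := h.exists_isPath_iterate (branchDist T p l) l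
      fun i hi => iterate_ne_root hb hi
    refine ⟨l, _, W, hW, W.start_mem_support, ?_, hlen⟩
    intro v hv hvl hvc
    obtain ⟨-, i, hi, rfl⟩ := hsupp v hv
    have hi' : i < branchDist T p l := lt_of_le_of_ne hi fun he => hvc (by rw [he, hc])
    have h1 := degree_iterate_lt_three hi'
    cases i with
    | zero => exact absurd rfl hvl
    | succ i =>
      have h2 := h.two_le_degree_parent hb (iterate_ne_root hb (Nat.lt_of_succ_lt hi'))
      rw [← Function.iterate_succ_apply' p, Nat.succ_eq_add_one] at h2
      omega
  · rintro n ⟨a, c, P, hP, hlP, hint, rfl⟩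
    by_cases hla : l = a
    · subst hla
      exact hupper P hP hint
    · by_cases hlc : l = c
      · subst hlc
        rw [← P.length_reverse]
        refine hupper P.reverse hP.reverse fun v hv h1 h2 => ?_
        rw [SimpleGraph.Walk.support_reverse, List.mem_reverse] at hv
        exact hint v hv h2 h1
      · have := hint l hlP hla hlc
        omega

end IsParentMap

namespace IsParentMap

variable {V : Type*} [Fintype V] {T : SimpleGraph V} {b : V} {p : V → V} {d : V → ℕ}

/-- The vertices left after removing the first `x l` vertices of the twig of each leaf `l`. -/
noncomputable def trim (T : SimpleGraph V) (p : V → V) (x : leaves T → ℕ) : Finset V :=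
  Finset.univ.filter fun v => ∀ (l : leaves T) (i : ℕ), p^[i] l = v → x l ≤ i

theorem mem_trim {x : leaves T → ℕ} {v : V} :
    v ∈ trim T p x ↔ ∀ (l : leaves T) (i : ℕ), p^[i] l = v → x l ≤ i := by
  simp [trim]

theorem degree_leaf (l : leaves T) : T.degree (l : V) = 1 := (Finset.mem_filter.mp l.2).2

theorem mem_trim_of_three_le_degree {x : leaves T → ℕ} (hx : ∀ l, x l < branchDist T p l) {v : V}
    (hv : 3 ≤ T.degree v) : v ∈ trim T p x := by
  rw [mem_trim]
  rintro l i rfl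
  by_contra hlt
  have := degree_iterate_lt_three ((not_le.mp hlt).trans (hx l))
  omega

theorem parent_mem_trim (h : IsParentMap T b p d) (hb : 3 ≤ T.degree b) {x : leaves T → ℕ}
    (hx : ∀ l, x l < branchDist T p l) {v : V} (hv : v ∈ trim T p x) : p v ∈ trim T p x := by
  by_cases hvb : v = b
  · subst hvb; rwa [h.root]
  rw [mem_trim] at hv ⊢
  intro l i hi
  by_contra hlt
  have hit := (not_le.mp hlt).trans (hx l)
  have hdeg := degree_iterate_lt_three hit
  cases i with
  | zero =>
    have := h.two_le_degree_parent hb hvb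
    rw [← hi, Function.iterate_zero, id, degree_leaf] at this
    omega
  | succ i =>
    rw [Function.iterate_succ_apply'] at hi hdeg
    have hne := iterate_ne_root hb (Nat.lt_of_succ_lt hit)
    have : p^[i] l = v := by
      by_contra hne'
      have := h.three_le_degree_of_parent_eq hb hne hvb hne' hi
      omega
    have := hv l i this
    omega

theorem child_mem_trim {x : leaves T → ℕ}
    (hx : ∀ l, x l < branchDist T p l) {v : V} (hv : 3 ≤ T.degree (p v)) : v ∈ trim T p x := by
  rw [mem_trim]
  rintro l i rfl
  rw [← Function.iterate_succ_apply' p] at hv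
  by_contra hlt
  have := degree_iterate_lt_three (show i.succ < branchDist T p l from
    lt_of_le_of_lt (Nat.succ_le_of_lt (not_le.mp hlt)) (hx l))
  omega

theorem isSubtree_of_parent_mem (h : IsParentMap T b p d) (hb : 3 ≤ T.degree b) {A : Finset V}
    (hA : ∀ v ∈ A, p v ∈ A) (hbA : b ∈ A) (hnb : ∀ u, T.Adj b u → u ∈ A) : IsSubtree T A := by
  refine ⟨(h.connected_iff A hbA).mpr hA, b, hbA, ?_⟩
  obtain ⟨u, hu⟩ := (T.degree_pos_iff_exists_adj b).mp (by omega)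
  exact ⟨u, hnb u hu, hu⟩

theorem neighbor_mem_trim (h : IsParentMap T b p d) (hb : 3 ≤ T.degree b) {x : leaves T → ℕ}
    (hx : ∀ l, x l < branchDist T p l) {v u : V} (hv : 3 ≤ T.degree v) (hu : T.Adj v u) :
    u ∈ trim T p x := by
  rcases h.eq_or_eq v u hu with ⟨-, rfl⟩ | ⟨-, rfl⟩
  · exact h.parent_mem_trim hb hx (mem_trim_of_three_le_degree hx hv)
  · exact child_mem_trim hx hv

theorem isSubtree_trim (h : IsParentMap T b p d) (hb : 3 ≤ T.degree b) {x : leaves T → ℕ}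
    (hx : ∀ l, x l < branchDist T p l) : IsSubtree T (trim T p x) :=
  h.isSubtree_of_parent_mem hb (fun _ hv => h.parent_mem_trim hb hx hv)
    (mem_trim_of_three_le_degree hx hb) fun _ hu => h.neighbor_mem_trim hb hx hb hu

theorem leafCount_trim (h : IsParentMap T b p d) (hT : T.IsTree) (hb : 3 ≤ T.degree b)
    {x : leaves T → ℕ} (hx : ∀ l, x l < branchDist T p l) :
    leafCount T (trim T p x) = (leaves T).card :=
  ((h.isSubtree_trim hb hx).leafCount_eq_card_leaves_iff hT ⟨b, hb⟩).mpr fun _ hv =>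
    ⟨mem_trim_of_three_le_degree hx hv, fun _ hu => h.neighbor_mem_trim hb hx hv hu⟩

theorem iterate_mem_trim_iff (h : IsParentMap T b p d) (hb : 3 ≤ T.degree b)
    {x : leaves T → ℕ} (hx : ∀ l, x l < branchDist T p l) (l : leaves T) (i : ℕ) :
    p^[i] l ∈ trim T p x ↔ x l ≤ i := by
  refine ⟨fun hi => mem_trim.mp hi l i rfl, fun hi => ?_⟩
  induction i, hi using Nat.le_induction with
  | base =>
    rw [mem_trim]
    intro l' k hk
    by_contra hlt
    obtain ⟨h1, h2⟩ := h.iterate_inj hb (degree_leaf l') (degree_leaf l)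
      ((not_le.mp hlt).trans (hx l')) (hx l) hk
    obtain rfl := Subtype.ext h1
    omega
  | succ i _ ih =>
    rw [Function.iterate_succ_apply']
    exact h.parent_mem_trim hb hx ih

theorem card_trim (h : IsParentMap T b p d) (hb : 3 ≤ T.degree b)
    {x : leaves T → ℕ} (hx : ∀ l, x l < branchDist T p l) :
    (trim T p x).card + ∑ l, x l = Fintype.card V := by
  have hc : (Finset.univ.sigma fun l => Finset.range (x l)).image
      (fun a : (_ : leaves T) × ℕ => p^[a.2] (a.1 : V)) = (trim T p x)ᶜ := by
    ext v
    simp only [Finset.mem_image, Finset.mem_sigma, Finset.mem_univ, true_and, Finset.mem_range,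
      Finset.mem_compl, mem_trim, not_forall, not_le]
    constructor
    · rintro ⟨⟨l, i⟩, h1, h2⟩
      exact ⟨l, i, h2, h1⟩
    · rintro ⟨l, i, h2, h1⟩
      exact ⟨⟨l, i⟩, h1, h2⟩
  have hcard := congrArg Finset.card hc
  rw [Finset.card_image_of_injOn, Finset.card_sigma] at hcard
  · simp only [Finset.card_range] at hcard
    rw [hcard, Finset.card_add_card_compl]
  · rintro ⟨l, i⟩ hli ⟨l', j⟩ hlj he
    simp only [Finset.coe_sigma, Set.mem_sigma_iff, Finset.coe_univ, Set.mem_univ, true_and,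
      Finset.coe_range, Set.mem_Iio] at hli hlj
    obtain ⟨h1, h2⟩ := h.iterate_inj hb (degree_leaf l) (degree_leaf l')
      (hli.trans (hx l)) (hlj.trans (hx l')) he
    obtain rfl := Subtype.ext h1
    rw [h2]

theorem exists_eq_iterate_of_notMem (h : IsParentMap T b p d) {A : Finset V}
    (hA : ∀ v ∈ A, p v ∈ A) (hbA : b ∈ A)
    {v : V} (hv : v ∉ A) : ∃ (l : leaves T) (i : ℕ), p^[i] l = v := by
  obtain ⟨D, hD⟩ : ∃ D, ∀ v, d v ≤ D :=
    ⟨Finset.univ.sup d, fun v => Finset.le_sup (Finset.mem_univ v)⟩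
  induction hn : D - d v using Nat.strong_induction_on generalizing v with
  | _ n ih =>
    have hvb : v ≠ b := fun he => hv (he ▸ hbA)
    by_cases h2 : 2 ≤ T.degree v
    · obtain ⟨w, hwb, rfl⟩ := h.exists_child h2
      have hlt := h.depth_lt w hwb
      have hw := hD w
      obtain ⟨l, i, rfl⟩ := ih _ (by omega) (fun hw => hv (hA w hw)) rfl
      exact ⟨l, i + 1, Function.iterate_succ_apply' p i _⟩
    · have := h.degree_pos hvb
      exact ⟨⟨v, Finset.mem_filter.mpr ⟨Finset.mem_univ v, by omega⟩⟩, 0, rfl⟩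

theorem sInf_lt_branchDist (h : IsParentMap T b p d) (hb : 3 ≤ T.degree b) {A : Finset V}
    (hbranch : ∀ v, 3 ≤ T.degree v → v ∈ A ∧ ∀ u, T.Adj v u → u ∈ A) (l : leaves T) :
    sInf {i | p^[i] (l : V) ∈ A} < branchDist T p l := by
  have hpos := h.branchDist_pos hb (degree_leaf l)
  obtain ⟨k, hk⟩ := Nat.exists_eq_succ_of_ne_zero hpos.ne'
  have h1 := h.three_le_degree_branch hb (l : V)
  have hne := iterate_ne_root (p := p) hb (show k < branchDist T p l by omega)
  have hadj := h.adj _ hne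
  rw [← Function.iterate_succ_apply' p, ← hk] at hadj
  have hmem : p^[k] (l : V) ∈ A := (hbranch _ h1).2 _ hadj.symm
  have := Nat.sInf_le (s := {i | p^[i] (l : V) ∈ A}) hmem
  omega

theorem trim_sInf (h : IsParentMap T b p d) (hb : 3 ≤ T.degree b) {A : Finset V}
    (hA : ∀ v ∈ A, p v ∈ A)
    (hbranch : ∀ v, 3 ≤ T.degree v → v ∈ A ∧ ∀ u, T.Adj v u → u ∈ A) :
    trim T p (fun l => sInf {i | p^[i] (l : V) ∈ A}) = A := by
  ext v
  rw [mem_trim]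
  constructor
  · intro hv
    by_contra hvA
    obtain ⟨l, i, rfl⟩ := h.exists_eq_iterate_of_notMem hA (hbranch b hb).1 hvA
    have hle := hv l i rfl
    have hmem : sInf {i | p^[i] (l : V) ∈ A} ∈ {i | p^[i] (l : V) ∈ A} :=
      Nat.sInf_mem ⟨_, (hbranch _ (h.three_le_degree_branch hb (l : V))).1⟩
    refine hvA (Nat.le_induction hmem (fun k _ hk => ?_) i hle)
    rw [Function.iterate_succ_apply']
    exact hA _ hk
  · rintro hv l i rfl
    exact Nat.sInf_le (s := {i | p^[i] (l : V) ∈ A}) hv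

open Polynomial in
theorem sum_X_pow_eq_prod (h : IsParentMap T b p d) (hT : T.IsTree) (hb : 3 ≤ T.degree b) :
    ∑ A ∈ (Finset.univ.powerset.filter fun A => IsSubtree T A).filter
      (fun A => leafCount T A = (leaves T).card),
      (X : ℂ[X]) ^ (Fintype.card V - 1 - edgeCount T A) =
      ((twigLengths T).map fun t => ∑ i ∈ Finset.range t, (X : ℂ[X]) ^ i).prod := by
  have h1 : ((twigLengths T).map fun t => ∑ i ∈ Finset.range t, (X : ℂ[X]) ^ i).prod =
      ∏ l : leaves T, ∑ i ∈ Finset.range (branchDist T p l), (X : ℂ[X]) ^ i := by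
    rw [Finset.prod_coe_sort (leaves T)
      fun l => ∑ i ∈ Finset.range (branchDist T p l), (X : ℂ[X]) ^ i, twigLengths, Multiset.map_map]
    refine Finset.prod_congr rfl fun l hl => ?_
    rw [Function.comp_apply, h.twigLen_eq hb (Finset.mem_filter.mp hl).2]
  rw [h1, Finset.prod_univ_sum]
  symm
  refine Finset.sum_nbij' (fun x => trim T p x) (fun A l => sInf {i | p^[i] (l : V) ∈ A})
    ?_ ?_ ?_ ?_ ?_
  · intro x hx
    simp only [Fintype.mem_piFinset, Finset.mem_range] at hx
    simp [h.isSubtree_trim hb hx, h.leafCount_trim hT hb hx]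
  · intro A hA
    simp only [Finset.mem_filter, Finset.mem_powerset, Finset.subset_univ, true_and] at hA
    simp only [Fintype.mem_piFinset, Finset.mem_range]
    exact h.sInf_lt_branchDist hb ((hA.1.leafCount_eq_card_leaves_iff hT ⟨b, hb⟩).mp hA.2)
  · intro x hx
    simp only [Fintype.mem_piFinset, Finset.mem_range] at hx
    funext l
    simp only [h.iterate_mem_trim_iff hb hx]
    exact csInf_Ici
  · intro A hA
    simp only [Finset.mem_filter, Finset.mem_powerset, Finset.subset_univ, true_and] at hA
    have hbr := (hA.1.leafCount_eq_card_leaves_iff hT ⟨b, hb⟩).mp hA.2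
    exact h.trim_sInf hb ((h.connected_iff A (hbr b hb).1).mp hA.1.1) hbr
  · intro x hx
    simp only [Fintype.mem_piFinset, Finset.mem_range] at hx
    rw [Finset.prod_pow_eq_pow_sum]
    congr 1
    have h2 := h.card_trim hb hx
    have h3 := (h.isSubtree_trim hb hx).edgeCount_add_one hT
    omega

end IsParentMap

/-- The multiset of pairs (number of edges, number of leaves) over all subtrees of `T`. -/
noncomputable def subtreeStats {V : Type*} [Fintype V] (T : SimpleGraph V) : Multiset (ℕ × ℕ) :=
  (Finset.univ.powerset.filter fun A => IsSubtree T A).val.map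
    fun A => (edgeCount T A, leafCount T A)

theorem coeff_subtreePoly {V : Type*} [Fintype V] (T : SimpleGraph V) (e k : ℕ) :
    (subtreePoly T).coeff (Finsupp.single 0 e + Finsupp.single 1 k) =
      (subtreeStats T).count (e, k) := by
  have hmon : ∀ A : Finset V, (MvPolynomial.X 0 ^ edgeCount T A * MvPolynomial.X 1 ^ leafCount T A :
      MvPolynomial (Fin 2) ℤ) = MvPolynomial.monomial
        (Finsupp.single 0 (edgeCount T A) + Finsupp.single 1 (leafCount T A)) 1 := by
    intro A
    rw [MvPolynomial.X_pow_eq_monomial, MvPolynomial.X_pow_eq_monomial,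
      MvPolynomial.monomial_mul, one_mul]
  have hinj : ∀ e' k' : ℕ, (Finsupp.single (0 : Fin 2) e' + Finsupp.single 1 k' =
      Finsupp.single 0 e + Finsupp.single 1 k) ↔ (e, k) = (e', k') := by
    intro e' k'
    constructor
    · intro he
      have h0 := DFunLike.congr_fun he 0
      have h1 := DFunLike.congr_fun he 1
      simp at h0 h1
      rw [h0, h1]
    · intro he
      obtain ⟨rfl, rfl⟩ := Prod.mk.inj he
      rfl
  rw [subtreePoly, MvPolynomial.coeff_sum, subtreeStats, Multiset.count_map]
  simp only [hmon, MvPolynomial.coeff_monomial, hinj]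
  rw [Finset.sum_boole, Finset.card_def, Finset.filter_val]

theorem subtreeStats_eq_of_subtreePoly_eq {V V' : Type*} [Fintype V] [Fintype V']
    {T : SimpleGraph V} {T' : SimpleGraph V'} (h : subtreePoly T = subtreePoly T') :
    subtreeStats T = subtreeStats T' := by
  ext ⟨e, k⟩
  have := coeff_subtreePoly T e k
  rw [h, coeff_subtreePoly] at this
  exact_mod_cast this.symm

theorem mem_subtreeStats {V : Type*} [Fintype V] {T : SimpleGraph V} (hT : T.IsTree)
    (hdeg : ∃ v : V, 3 ≤ T.degree v) :
    (Fintype.card V - 1, (leaves T).card) ∈ subtreeStats T := by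
  have h := hT.isSubtree_univ hdeg
  have h1 := h.edgeCount_add_one hT
  refine Multiset.mem_map.mpr ⟨Finset.univ, by simpa using h, ?_⟩
  rw [leafCount_univ, ← Finset.card_univ, ← h1, Nat.add_sub_cancel]

theorem le_of_mem_subtreeStats {V : Type*} [Fintype V] {T : SimpleGraph V} (hT : T.IsTree)
    (hdeg : ∃ v : V, 3 ≤ T.degree v) {x : ℕ × ℕ} (hx : x ∈ subtreeStats T) :
    x ≤ (Fintype.card V - 1, (leaves T).card) := by
  obtain ⟨A, hA, rfl⟩ := Multiset.mem_map.mp hx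
  rw [Finset.mem_val, Finset.mem_filter] at hA
  have h1 := hA.2.edgeCount_add_one hT
  have h2 := A.card_le_univ
  exact ⟨by simp only; omega, hA.2.leafCount_le hT hdeg⟩

open Polynomial in
theorem prod_twigLengths_eq {V : Type*} [Fintype V] {T : SimpleGraph V} (hT : T.IsTree)
    (hdeg : ∃ v : V, 3 ≤ T.degree v) :
    ((twigLengths T).map fun t => ∑ i ∈ Finset.range t, (X : ℂ[X]) ^ i).prod =
      (((subtreeStats T).filter fun x => x.2 = (leaves T).card).map
        fun x => (X : ℂ[X]) ^ (Fintype.card V - 1 - x.1)).sum := by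
  obtain ⟨b, hb⟩ := hdeg
  obtain ⟨p, d, h⟩ := hT.exists_isParentMap b
  rw [← h.sum_X_pow_eq_prod hT hb, subtreeStats, Multiset.filter_map, Multiset.map_map]
  rfl

theorem twigLengths_pos {V : Type*} [Fintype V] {T : SimpleGraph V} (hT : T.IsTree)
    (hdeg : ∃ v : V, 3 ≤ T.degree v) : ∀ t ∈ twigLengths T, 0 < t := by
  obtain ⟨b, hb⟩ := hdeg
  obtain ⟨p, d, h⟩ := hT.exists_isParentMap b
  intro t ht
  obtain ⟨l, hl, rfl⟩ := Multiset.mem_map.mp ht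
  have hl' := (Finset.mem_filter.mp hl).2
  rw [h.twigLen_eq hb hl']
  exact h.branchDist_pos hb hl'

open Polynomial in
theorem Multiset.prod_X_pow_sub_one (s : Multiset ℕ) :
    (s.map fun t => (X : ℂ[X]) ^ t - 1).prod =
      (s.map fun t => ∑ i ∈ Finset.range t, (X : ℂ[X]) ^ i).prod * (X - 1) ^ s.card := by
  simp_rw [← geom_sum_mul, Multiset.prod_map_mul, Multiset.map_const', Multiset.prod_replicate]

theorem stmt3 {V V' : Type*} [Fintype V] [Fintype V']
    (T : SimpleGraph V) (T' : SimpleGraph V') (hT : T.IsTree) (hT' : T'.IsTree)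
    (hdeg : ∃ v : V, 3 ≤ T.degree v) (hdeg' : ∃ v : V', 3 ≤ T'.degree v)
    (h : subtreePoly T = subtreePoly T') :
    twigLengths T = twigLengths T' := by
  have hstats := subtreeStats_eq_of_subtreePoly_eq h
  have hNL : (Fintype.card V - 1, (leaves T).card) =
      (Fintype.card V' - 1, (leaves T').card) :=
    le_antisymm (le_of_mem_subtreeStats hT' hdeg' (hstats ▸ mem_subtreeStats hT hdeg))
      (le_of_mem_subtreeStats hT hdeg (hstats ▸ mem_subtreeStats hT' hdeg'))
  obtain ⟨hN, hL⟩ := Prod.mk.inj hNL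
  refine Multiset.eq_of_prod_X_pow_sub_one_eq _ _ (twigLengths_pos hT hdeg)
    (twigLengths_pos hT' hdeg') ?_
  have hcard : (twigLengths T).card = (twigLengths T').card := by
    simpa [twigLengths] using hL
  rw [Multiset.prod_X_pow_sub_one, Multiset.prod_X_pow_sub_one, hcard,
    prod_twigLengths_eq hT hdeg, prod_twigLengths_eq hT' hdeg', hstats, hL, hN]
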